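/- For all integers k ≥ 2 and all integers p with 0 ≤ p ≤ k, the identity F̄_p^k = F̄_p^{k−1} + (1 − x_k)·F̄_{p−1}^{k−1} − q_{k−1}·(1 − x_{k−1})·F̄_{p−1}^{k−2} holds in ℤ[q_1, q_2, …, x_1, x_2, …]. -/

import Mathlib

open MvPolynomial Finset

noncomputable section

/-- The polynomial ring `ℤ[q_1, q_2, …, x_1, x_2, …]`; the variable `Sum.inl i` is `q_i`
and `Sum.inr i` is `x_i`. -/
abbrev P : Type := MvPolynomial (ℕ ⊕ ℕ) ℤ

/-- The variable `q_i`. -/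
def qv (i : ℕ) : P := X (Sum.inl i)

/-- The variable `x_i`. -/
def xv (i : ℕ) : P := X (Sum.inr i)

/-- The polynomial `F_p^k`, defined as `0` unless `0 ≤ p ≤ k`. -/
def Fp (p k : ℤ) : P :=
  if 0 ≤ p ∧ p ≤ k then
    ∑ I ∈ (Finset.Icc 1 k.toNat).powersetCard p.toNat,
      (∏ i ∈ I, (1 - xv i)) * ∏ i ∈ I.filter (fun i => i + 1 ∉ I), (1 - qv i)
  else 0

/-- The substitution `q_k ↦ 0`. -/
def setQ (k : ℕ) : P →ₐ[ℤ] P :=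
  aeval (fun v => if v = Sum.inl k then 0 else X v)

/-- `F̄_p^k`, i.e. `F_p^k` with `q_k` set to `0`. -/
def Fbar (p k : ℤ) : P := setQ k.toNat (Fp p k)

lemma setQ_one_sub_xv (k i : ℕ) : setQ k (1 - xv i) = 1 - xv i := by
  simp [setQ, xv]

lemma setQ_one_sub_qv (k i : ℕ) : setQ k (1 - qv i) = if i = k then 1 else 1 - qv i := by
  by_cases h : i = k <;> simp [setQ, qv, h]

/-- The summand of `F_p^k` indexed by `I`. -/
def weight (I : Finset ℕ) : P :=
  (∏ i ∈ I, (1 - xv i)) * ∏ i ∈ I.filter (fun i => i + 1 ∉ I), (1 - qv i)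

lemma setQ_weight (k : ℕ) (I : Finset ℕ) :
    setQ k (weight I) = (∏ i ∈ I, (1 - xv i)) *
      ∏ i ∈ I, if i + 1 ∉ I then (if i = k then 1 else 1 - qv i) else 1 := by
  simp only [weight, map_mul, map_prod, setQ_one_sub_xv, setQ_one_sub_qv]
  rw [prod_filter]

lemma setQ_weight_of_notMem {k : ℕ} {I : Finset ℕ} (hk : k ∉ I) :
    setQ k (weight I) = weight I := by
  rw [setQ_weight, weight, prod_filter]
  congr 1
  refine prod_congr rfl fun i hi => ?_
  rw [if_neg (ne_of_mem_of_not_mem hi hk)]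

lemma weight_insert {k : ℕ} {I : Finset ℕ} (hI : ∀ i ∈ I, i ≤ k) :
    weight (insert (k + 1) I) = (1 - xv (k + 1)) * (1 - qv (k + 1)) * setQ k (weight I) := by
  have hk : k + 1 ∉ I := fun h => by have := hI _ h; omega
  have hk' : k + 1 + 1 ∉ insert (k + 1) I := fun h => by
    rcases mem_insert.1 h with h | h
    · omega
    · have := hI _ h; omega
  have hprod : (∏ i ∈ I, if i + 1 ∉ insert (k + 1) I then 1 - qv i else 1) =
      ∏ i ∈ I, if i + 1 ∉ I then (if i = k then 1 else 1 - qv i) else 1 := by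
    refine prod_congr rfl fun i _ => ?_
    by_cases h : i = k
    · simp [h]
    · simp [h, mem_insert]
  rw [setQ_weight, weight, prod_filter, prod_insert hk, prod_insert hk, if_pos hk', hprod]
  ring

lemma setQ_weight_insert {k : ℕ} {I : Finset ℕ} (hI : ∀ i ∈ I, i ≤ k) :
    setQ (k + 1) (weight (insert (k + 1) I)) = (1 - xv (k + 1)) * setQ k (weight I) := by
  have hfix : setQ (k + 1) (setQ k (weight I)) = setQ k (weight I) := by
    rw [setQ_weight k, map_mul, map_prod, map_prod]
    congr 1
    · simp only [setQ_one_sub_xv]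
    · refine prod_congr rfl fun i hi => ?_
      have : i ≠ k + 1 := by have := hI i hi; omega
      split_ifs <;> simp only [map_one, setQ_one_sub_qv, if_neg this]
  rw [weight_insert hI, map_mul, map_mul, setQ_one_sub_xv, setQ_one_sub_qv, if_pos rfl, mul_one,
    hfix]

lemma sum_powersetCard_succ_insert {α M : Type*} [DecidableEq α] [AddCommMonoid M] {a : α}
    {s : Finset α} (ha : a ∉ s) (n : ℕ) (f : Finset α → M) :
    ∑ t ∈ (insert a s).powersetCard (n + 1), f t =
      ∑ t ∈ s.powersetCard (n + 1), f t + ∑ t ∈ s.powersetCard n, f (insert a t) := by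
  have hmem : ∀ {m : ℕ} {t : Finset α}, t ∈ s.powersetCard m → a ∉ t :=
    fun ht h => ha ((mem_powersetCard.1 ht).1 h)
  rw [powersetCard_succ_insert ha, sum_union, sum_image]
  · intro t ht u hu htu
    rw [← erase_insert (hmem ht), ← erase_insert (hmem hu), htu]
  · rw [disjoint_left]
    intro t ht h
    obtain ⟨u, -, rfl⟩ := mem_image.1 h
    exact hmem ht (mem_insert_self a u)

lemma Fp_natCast (p k : ℕ) : Fp p k = ∑ I ∈ (Icc 1 k).powersetCard p, weight I := by
  unfold Fp
  split_ifs with h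
  · rfl
  · rw [powersetCard_eq_empty.2 (by simp; omega), sum_empty]

lemma Fbar_natCast (p k : ℕ) :
    Fbar p k = ∑ I ∈ (Icc 1 k).powersetCard p, setQ k (weight I) := by
  rw [Fbar, Fp_natCast, map_sum, Int.toNat_natCast]

lemma le_of_mem_of_mem_powersetCard {p k : ℕ} {I : Finset ℕ} (hI : I ∈ (Icc 1 k).powersetCard p) :
    ∀ i ∈ I, i ≤ k :=
  fun _ hi => (mem_Icc.1 ((mem_powersetCard.1 hI).1 hi)).2

lemma Fp_succ_succ (p k : ℕ) :
    Fp (p + 1 : ℕ) (k + 1 : ℕ) =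
      Fp (p + 1 : ℕ) k + (1 - xv (k + 1)) * (1 - qv (k + 1)) * Fbar p k := by
  rw [Fp_natCast, Fp_natCast, Fbar_natCast, ← insert_Icc_right_eq_Icc_add_one (by omega),
    sum_powersetCard_succ_insert (by simp), mul_sum]
  congr 1
  exact sum_congr rfl fun I hI => weight_insert (le_of_mem_of_mem_powersetCard hI)

lemma Fbar_succ_succ (p k : ℕ) :
    Fbar (p + 1 : ℕ) (k + 1 : ℕ) = Fp (p + 1 : ℕ) k + (1 - xv (k + 1)) * Fbar p k := by
  rw [Fbar_natCast, Fp_natCast, Fbar_natCast, ← insert_Icc_right_eq_Icc_add_one (by omega),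
    sum_powersetCard_succ_insert (by simp), mul_sum]
  congr 1
  · refine sum_congr rfl fun I hI => setQ_weight_of_notMem fun h => ?_
    have := le_of_mem_of_mem_powersetCard hI _ h
    omega
  · exact sum_congr rfl fun I hI => setQ_weight_insert (le_of_mem_of_mem_powersetCard hI)

lemma Fbar_zero (k : ℕ) : Fbar 0 k = 1 := by
  rw [← Nat.cast_zero, Fbar_natCast]
  simp [weight]

lemma Fbar_neg_one (k : ℤ) : Fbar (-1) k = 0 := by
  simp [Fbar, Fp]

/-- For all integers `k ≥ 2` and `0 ≤ p ≤ k`,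
`F̄_p^k = F̄_p^{k−1} + (1 − x_k)·F̄_{p−1}^{k−1} − q_{k−1}·(1 − x_{k−1})·F̄_{p−1}^{k−2}`. -/
theorem statement2 (k p : ℤ) (hk : 2 ≤ k) (hp : 0 ≤ p) (hpk : p ≤ k) :
    Fbar p k = Fbar p (k - 1) + (1 - xv k.toNat) * Fbar (p - 1) (k - 1)
      - qv (k - 1).toNat * (1 - xv (k - 1).toNat) * Fbar (p - 1) (k - 2) := by
  obtain ⟨m, rfl⟩ : ∃ m : ℕ, k = (m + 1 + 1 : ℕ) := ⟨(k - 2).toNat, by omega⟩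
  have h1 : ((m + 1 + 1 : ℕ) : ℤ) - 1 = (m + 1 : ℕ) := by omega
  have h2 : ((m + 1 + 1 : ℕ) : ℤ) - 2 = (m : ℕ) := by omega
  rw [h1, h2, Int.toNat_natCast, Int.toNat_natCast]
  obtain ⟨n, rfl⟩ := Int.eq_ofNat_of_zero_le hp
  cases n with
  | zero => simp only [Nat.cast_zero, zero_sub, Fbar_neg_one, Fbar_zero]; ring
  | succ n =>
    have h3 : ((n + 1 : ℕ) : ℤ) - 1 = (n : ℕ) := by omega
    rw [h3, Fbar_succ_succ n (m + 1), Fp_succ_succ, Fbar_succ_succ n m]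
    ring
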